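/- arXiv:0807.4401 — 4 statements merged into one kernel-verified Lean document; each statement's English description precedes it below -/
import Mathlib

section
/- Let q, n, s be integers with 0 ≤ s < n, let F be a subset of ℝ^q, and let C : F → M_n(ℝ) be a Lipschitz map into the real n × n matrices such that the rank of C(x) equals s for every x ∈ F. Set h = n − s. Then every point x₀ ∈ F has a relatively open neighborhood A of x₀ in F on which there exist Lipschitz maps T₁, …, T_h : A → ℝ^n such that for every x ∈ A the vectors T₁(x), …, T_h(x) are linearly independent and their span equals the kernel of the linear map ℝ^n → ℝ^n given by matrix–vector multiplication by C(x). -/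
/-- Every endomorphism of a vector space has a generalized inverse. -/
theorem LinearMap.exists_comp_comp_eq_self {k V : Type*} [Field k] [AddCommGroup V] [Module k V]
    (f : V →ₗ[k] V) : ∃ g : V →ₗ[k] V, f ∘ₗ g ∘ₗ f = f := by
  obtain ⟨r, hr⟩ := f.rangeRestrict.exists_rightInverse_of_surjective f.range_rangeRestrict
  obtain ⟨g, hg⟩ := LinearMap.exists_extend r
  refine ⟨g, LinearMap.ext fun v => ?_⟩
  have h₁ : g (f v) = r (f.rangeRestrict v) := LinearMap.congr_fun hg (f.rangeRestrict v)
  have h₂ := congrArg Subtype.val (LinearMap.congr_fun hr (f.rangeRestrict v))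
  simpa [h₁] using h₂

/-- If `a b a = a` and `l = 1 + b (c - a)` has a left inverse `g`, then `g` maps `ker a` onto
`ker c`, provided the two kernels have the same dimension. -/
theorem LinearMap.map_ker_eq_ker_of_finrank_eq {k V : Type*} [Field k] [AddCommGroup V]
    [Module k V] [FiniteDimensional k V] {a b c g : V →ₗ[k] V} (hab : a ∘ₗ b ∘ₗ a = a)
    (hgl : ∀ v, g (v + b (c v - a v)) = v) (hg : Function.Injective g)
    (hdim : Module.finrank k (LinearMap.ker c) = Module.finrank k (LinearMap.ker a)) :
    (LinearMap.ker a).map g = LinearMap.ker c := by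
  symm
  refine Submodule.eq_of_le_of_finrank_eq (fun v hv => ?_) ?_
  · rw [LinearMap.mem_ker] at hv
    refine ⟨v + b (c v - a v), ?_, hgl v⟩
    have := LinearMap.congr_fun hab v
    simp only [LinearMap.comp_apply] at this
    simp [hv, this]
  · rw [hdim]
    exact ((LinearMap.ker a).equivMapOfInjective g hg).finrank_eq

/-- The kernel of an `n × n` matrix acting on Euclidean space has dimension `n - rank`. -/
theorem Matrix.finrank_ker_toEuclideanCLM {n : ℕ} (A : Matrix (Fin n) (Fin n) ℝ) :
    Module.finrank ℝ (LinearMap.ker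
      (Matrix.toEuclideanCLM (𝕜 := ℝ) A).toLinearMap) = n - A.rank := by
  have h := (Matrix.toEuclideanCLM (𝕜 := ℝ) A).toLinearMap.finrank_range_add_finrank_ker
  have hr : A.rank = Module.finrank ℝ (LinearMap.range
      (Matrix.toEuclideanCLM (𝕜 := ℝ) A).toLinearMap) :=
    A.rank_eq_finrank_range_toLin (EuclideanSpace.basisFun (Fin n) ℝ).toBasis
      (EuclideanSpace.basisFun (Fin n) ℝ).toBasis
  rw [finrank_euclideanSpace_fin] at h
  omega

attribute [local instance] Matrix.normedAddCommGroup Matrix.normedSpace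

/-- If `C : F → Mₙ(ℝ)` is a Lipschitz matrix-valued map of constant rank `s < n`
on a set `F ⊆ ℝ^q`, then around each point of `F` there is a relatively open neighborhood
`F ∩ U` carrying `h = n - s` Lipschitz vector fields `T₁, …, T_h` that at every point are
linearly independent and span the kernel of the matrix. -/
theorem lipschitz_kernel_frame_of_constant_rank
    (q n s : ℕ) (hsn : s < n)
    (F : Set (EuclideanSpace ℝ (Fin q)))
    (C : EuclideanSpace ℝ (Fin q) → Matrix (Fin n) (Fin n) ℝ)
    (K : NNReal) (hC : LipschitzOnWith K C F)
    (hrank : ∀ x ∈ F, (C x).rank = s)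
    (x₀ : EuclideanSpace ℝ (Fin q)) (hx₀ : x₀ ∈ F) :
    ∃ U : Set (EuclideanSpace ℝ (Fin q)), IsOpen U ∧ x₀ ∈ U ∧
      ∃ T : Fin (n - s) → EuclideanSpace ℝ (Fin q) → EuclideanSpace ℝ (Fin n),
        (∃ K' : NNReal, ∀ i, LipschitzOnWith K' (T i) (F ∩ U)) ∧
        ∀ x ∈ F ∩ U,
          LinearIndependent ℝ (fun i => T i x) ∧
          (Submodule.span ℝ (Set.range fun i => T i x) : Set (EuclideanSpace ℝ (Fin n)))
            = {v : EuclideanSpace ℝ (Fin n) | (C x).mulVec v = 0} := by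
  let φ := (Matrix.toEuclideanCLM (n := Fin n) (𝕜 := ℝ))
  let φc := LinearMap.toContinuousLinearMap φ.toAlgEquiv.toLinearMap
  obtain ⟨b, hb⟩ := (φ (C x₀)).toLinearMap.exists_comp_comp_eq_self
  let B := LinearMap.toContinuousLinearMap b
  let L := fun x => 1 + B * (φ (C x) - φ (C x₀))
  have hL : ∃ K₁, LipschitzOnWith K₁ L F := by
    let ψ := (ContinuousLinearMap.compL ℝ _ _ _ B).comp φc
    obtain ⟨K₀, hψ⟩ : ∃ K₀, LipschitzOnWith K₀ (ψ ∘ C) F :=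
      ⟨_, ψ.lipschitz.comp_lipschitzOnWith hC⟩
    refine ⟨K₀, LipschitzOnWith.of_dist_le_mul fun x hx y hy => ?_⟩
    have := hψ.dist_le_mul x hx y hy
    rw [dist_eq_norm] at this ⊢
    convert this using 2
    change 1 + B * (φ (C x) - φ (C x₀)) - (1 + B * (φ (C y) - φ (C x₀)))
      = B * φ (C x) - B * φ (C y)
    noncomm_ring
  obtain ⟨K₁, hL⟩ := hL
  have hL₀ : L x₀ = 1 := by simp [L]
  obtain ⟨K₂, t, ht, hinv⟩ := (contDiffAt_ringInverse ℝ (n := 1)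
    (1 : (EuclideanSpace ℝ (Fin n) →L[ℝ] EuclideanSpace ℝ (Fin n))ˣ)).exists_lipschitzOnWith
  have hunit := Units.nhds (1 : (EuclideanSpace ℝ (Fin n) →L[ℝ] EuclideanSpace ℝ (Fin n))ˣ)
  have hmem : ∀ᶠ x in nhdsWithin x₀ F, L x ∈ t ∧ IsUnit (L x) := by
    have hcont : Filter.Tendsto L (nhdsWithin x₀ F) (nhds 1) := hL₀ ▸ hL.continuousOn x₀ hx₀
    exact hcont (Filter.inter_mem ht hunit)
  obtain ⟨U, hU, hxU, hUt⟩ := mem_nhdsWithin.1 hmem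
  let e := Module.finBasisOfFinrankEq ℝ (LinearMap.ker (φ (C x₀)).toLinearMap)
    ((Matrix.finrank_ker_toEuclideanCLM (C x₀)).trans (by rw [hrank x₀ hx₀]))
  refine ⟨U, hU, hxU, fun i x => Ring.inverse (L x) (e i), ?_, fun x hx => ?_⟩
  · have hG := hinv.comp (hL.mono Set.inter_subset_left) fun x hx => (hUt ⟨hx.2, hx.1⟩).1
    choose K₃ hK₃ using fun i => (⟨_, ((ContinuousLinearMap.apply ℝ (EuclideanSpace ℝ (Fin n))
      (e i : EuclideanSpace ℝ (Fin n))).lipschitz.comp_lipschitzOnWith hG)⟩ :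
        ∃ K₃, LipschitzOnWith K₃ (fun x => Ring.inverse (L x) (e i)) (F ∩ U))
    exact ⟨∑ i, K₃ i, fun i => (hK₃ i).weaken
      (Finset.single_le_sum (fun _ _ => zero_le) (Finset.mem_univ i))⟩
  · have hu : IsUnit (L x) := (hUt ⟨hx.2, hx.1⟩).2
    have hGL := Ring.inverse_mul_cancel _ hu
    have hLG := Ring.mul_inverse_cancel _ hu
    have hinj : Function.Injective (Ring.inverse (L x)).toLinearMap :=
      Function.LeftInverse.injective (g := L x) fun v => DFunLike.congr_fun hLG v
    have hmap := LinearMap.map_ker_eq_ker_of_finrank_eq (c := (φ (C x)).toLinearMap) hb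
      (fun v => DFunLike.congr_fun hGL v) hinj (by
        rw [Matrix.finrank_ker_toEuclideanCLM, Matrix.finrank_ker_toEuclideanCLM, hrank x hx.1,
          hrank x₀ hx₀])
    refine ⟨(e.linearIndependent.map' _ (Submodule.ker_subtype _)).map' _
      (LinearMap.ker_eq_bot.2 hinj), ?_⟩
    have hspan : Submodule.span ℝ (Set.range fun i => Ring.inverse (L x) (e i)) =
        LinearMap.ker (φ (C x)).toLinearMap := by
      have he := congrArg (Submodule.map (LinearMap.ker (φ (C x₀)).toLinearMap).subtype) e.span_eq
      rw [Submodule.map_span, Submodule.map_top, Submodule.range_subtype, ← Set.range_comp] at he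
      have hGe := congrArg (Submodule.map (Ring.inverse (L x)).toLinearMap) he
      rw [hmap, Submodule.map_span, ← Set.range_comp] at hGe
      exact hGe
    rw [hspan]
    ext v
    rw [SetLike.mem_coe, LinearMap.mem_ker, Set.mem_ofPred_eq, ← (WithLp.ofLp_injective 2).eq_iff]
    rfl
end

section
/- Let κ, a, l, b ≥ 0 be integers, set q = κ + a + l + b, write points of ℝ^q = ℝ^κ × ℝ^a × ℝ^l × ℝ^b as (x₁,x₂,x₃,x₄), and define for r > 0 the dilations δ_r(x₁,x₂,x₃,x₄) = (r x₁, r x₂, r² x₃, r² x₄). Let Ω ⊆ ℝ^a × ℝ^b be an open neighborhood of 0 and let α : Ω → ℝ^κ and β : Ω → ℝ^l be of class C² with α(0) = 0, β(0) = 0, and with all partial derivatives of all components of α and of β with respect to the ℝ^a-variables vanishing at 0. Set ψ(u,v) = (α(u,v), u, β(u,v), v) and Σ = ψ(Ω) ⊆ ℝ^q. Define Q : ℝ^a × ℝ^b → ℝ^l componentwise by Q_j(u,v) = Σ_{k=1}^{b} (∂β_j/∂v_k)(0) v_k + (1/2) Σ_{i,i'=1}^{a} (∂²β_j/∂u_i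 ∂u_{i'})(0) u_i u_{i'}, and let A = { (0, u, Q(u,v), v) : (u,v) ∈ ℝ^a × ℝ^b }. Then for every sequence of positive reals r_n → 0 the rescaled sets δ_{1/r_n}(Σ) converge to A in the sense of Kuratowski: (i) whenever z_n ∈ δ_{1/r_n}(Σ) for each n and z_n → z in ℝ^q, then z ∈ A; and (ii) for every z ∈ A there exist z_n ∈ δ_{1/r_n}(Σ) (for all n large enough) with z_n → z. -/
open Filter Topology Asymptotics

section Taylor

variable {E F : Type*} [NormedAddCommGroup E] [NormedSpace ℝ E]
  [NormedAddCommGroup F] [NormedSpace ℝ F]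

/-- Second-order Taylor formula with Peano remainder at the origin of a normed space. -/
theorem ContDiffAt.taylor_two_isLittleO {f : E → F} (hf : ContDiffAt ℝ 2 f 0) :
    (fun w => f w - f 0 - fderiv ℝ f 0 w - (1 / 2 : ℝ) • fderiv ℝ (fderiv ℝ f) 0 w w)
      =o[𝓝 0] fun w => ‖w‖ ^ 2 := by
  have hsymm : IsSymmSndFDerivAt ℝ f 0 := hf.isSymmSndFDerivAt (by simp)
  have hdiff : ∀ᶠ w in 𝓝 (0 : E), DifferentiableAt ℝ f w :=
    (hf.eventually (by simp)).mono fun w hw => hw.differentiableAt (by simp)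
  have hf2 : HasFDerivAt (fderiv ℝ f) (fderiv ℝ (fderiv ℝ f) 0) 0 :=
    ((hf.fderiv_right (m := 1) (by norm_num)).differentiableAt (by simp)).hasFDerivAt
  rw [isLittleO_iff]
  intro ε hε
  have hbound := (hasFDerivAt_iff_isLittleO.1 hf2).def hε
  obtain ⟨δ, hδ, hball⟩ := Metric.eventually_nhds_iff.1 (hdiff.and hbound)
  filter_upwards [Metric.ball_mem_nhds (0 : E) hδ] with w hw
  have hw' : ‖w‖ < δ := by simpa using hw
  set B := fderiv ℝ (fderiv ℝ f) 0
  have hderiv : ∀ y ∈ Metric.closedBall (0 : E) ‖w‖, HasFDerivWithinAt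
      (fun y => f y - f 0 - fderiv ℝ f 0 y - (1 / 2 : ℝ) • B y y)
      (fderiv ℝ f y - fderiv ℝ f 0 - B y) (Metric.closedBall (0 : E) ‖w‖) y := by
    intro y hy
    have hy' : Dist.dist y 0 < δ := lt_of_le_of_lt (by simpa using hy) hw'
    have hquad := (B.hasFDerivAt_of_bilinear (hasFDerivAt_id y) (hasFDerivAt_id y)).const_smul
      (1 / 2 : ℝ)
    have hmain := (((hball hy').1.hasFDerivAt.sub_const (f 0)).sub
      (fderiv ℝ f 0).hasFDerivAt).sub hquad
    refine HasFDerivAt.hasFDerivWithinAt (hmain.congr_fderiv ?_)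
    ext h
    have : B h y = B y h := hsymm.eq h y
    simp [this, ← add_smul]
    norm_num
  have hnorm : ∀ y ∈ Metric.closedBall (0 : E) ‖w‖,
      ‖fderiv ℝ f y - fderiv ℝ f 0 - B y‖ ≤ ε * ‖w‖ := by
    intro y hy
    have hyw : ‖y‖ ≤ ‖w‖ := by simpa using hy
    have hy' : Dist.dist y 0 < δ := lt_of_le_of_lt (by simpa using hy) hw'
    have := (hball hy').2
    rw [sub_zero] at this
    exact this.trans (by gcongr)
  have := (convex_closedBall (0 : E) ‖w‖).norm_image_sub_le_of_norm_hasFDerivWithin_le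
    hderiv hnorm (x := 0) (y := w) (by simp) (by simp)
  simpa [pow_two, mul_assoc] using this

/-- Parabolic blow-up of a `C²` map whose derivative at the origin kills the first factor. -/
theorem ContDiffAt.tendsto_parabolic_blowup {G : Type*} [NormedAddCommGroup G] [NormedSpace ℝ G]
    {f : E × G → F} (hf : ContDiffAt ℝ 2 f 0) (hf0 : f 0 = 0)
    (hfu : ∀ u : E, fderiv ℝ f 0 (u, 0) = 0) {ι : Type*} {L : Filter ι} {r : ι → ℝ}
    (hr : ∀ n, 0 < r n) (hr0 : Tendsto r L (𝓝 0)) {p : ι → E × G} {q : E × G}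
    (hp : Tendsto p L (𝓝 q)) :
    Tendsto (fun n => ((r n)⁻¹ ^ 2) • f (r n • (p n).1, r n ^ 2 • (p n).2)) L
      (𝓝 (fderiv ℝ f 0 (0, q.2) + (1 / 2 : ℝ) • fderiv ℝ (fderiv ℝ f) 0 (q.1, 0) (q.1, 0))) := by
  set D := fderiv ℝ f 0
  set B := fderiv ℝ (fderiv ℝ f) 0
  have hp1 : Tendsto (fun n => (p n).1) L (𝓝 q.1) := (continuous_fst.tendsto q).comp hp
  have hp2 : Tendsto (fun n => (p n).2) L (𝓝 q.2) := (continuous_snd.tendsto q).comp hp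
  set c : ι → E × G := fun n => ((p n).1, r n • (p n).2) with hc_def
  have hc : Tendsto c L (𝓝 (q.1, 0)) := by
    simpa using hp1.prodMk_nhds (hr0.smul hp2)
  have hw : ∀ n, (r n • (p n).1, r n ^ 2 • (p n).2) = r n • c n := fun n => by
    simp [hc_def, smul_smul, pow_two]
  have hw0 : Tendsto (fun n => r n • c n) L (𝓝 0) := by simpa using hr0.smul hc
  have hrem : Tendsto (fun n => ((r n)⁻¹ ^ 2) •
      (f (r n • c n) - f 0 - D (r n • c n) - (1 / 2 : ℝ) • B (r n • c n) (r n • c n)))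
      L (𝓝 0) := by
    have hbig : (fun n => ‖r n • c n‖ ^ 2) =O[L] fun n => r n ^ 2 := by
      refine IsBigO.pow (IsBigO.norm_left ?_) 2
      simpa using (isBigO_refl r L).smul (hc.isBigO_one ℝ)
    have hlit := (hf.taylor_two_isLittleO.comp_tendsto hw0).trans_isBigO hbig
    have := (isBigO_refl (fun n => (r n)⁻¹ ^ 2) L).smul_isLittleO hlit
    refine (isLittleO_one_iff ℝ).1 (this.congr_right fun n => ?_)
    have := (hr n).ne'
    simp only [smul_eq_mul]
    field_simp
  have hlin : Tendsto (fun n => D (0, (p n).2)) L (𝓝 (D (0, q.2))) :=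
    (D.continuous.tendsto _).comp (tendsto_const_nhds.prodMk_nhds hp2)
  have hquad : Tendsto (fun n => (1 / 2 : ℝ) • B (c n) (c n)) L
      (𝓝 ((1 / 2 : ℝ) • B (q.1, 0) (q.1, 0))) :=
    ((B.isBoundedBilinearMap.continuous.tendsto _).comp (hc.prodMk_nhds hc)).const_smul _
  have hsum := (hrem.add hlin).add hquad
  rw [zero_add] at hsum
  refine hsum.congr fun n => ?_
  have hne := (hr n).ne'
  have hD : D (r n • c n) = r n ^ 2 • D (0, (p n).2) := by
    have : r n • c n = (r n • (p n).1, 0) + r n ^ 2 • ((0 : E), (p n).2) := by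
      simp [hc_def, smul_smul, pow_two]
    rw [this, map_add, hfu, map_smul, zero_add]
  rw [hw, hf0, hD]
  simp only [map_smul, _root_.smul_apply, smul_sub, smul_smul, sub_zero]
  have h1 : (r n)⁻¹ ^ 2 * r n ^ 2 = 1 := by field_simp
  have h2 : (r n)⁻¹ ^ 2 * (1 / 2 * (r n * r n)) = 1 / 2 := by field_simp
  simp only [h1, h2, one_smul]
  abel

end Taylor

/-- A continuous linear map on `(Fin a → ℝ) × G` vanishing on the basis vectors of the first factor
vanishes on that factor. -/
theorem ContinuousLinearMap.apply_prod_zero_of_single {a : ℕ} {F G : Type*}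
    [NormedAddCommGroup F] [NormedSpace ℝ F] [NormedAddCommGroup G] [NormedSpace ℝ G]
    (D : (Fin a → ℝ) × G →L[ℝ] F) (hD : ∀ i, D (Pi.single i 1, 0) = 0) (u : Fin a → ℝ) :
    D (u, 0) = 0 := by
  have := LinearMap.pi_apply_eq_sum_univ
    ((D : (Fin a → ℝ) × G →ₗ[ℝ] F) ∘ₗ LinearMap.inl ℝ (Fin a → ℝ) G) u
  simpa [hD, ← Pi.single_apply, Pi.single_comm] using this

/-- Blow-up of a `C²` graph-type surface
`Σ = {(α(u,v), u, β(u,v), v)} ⊆ ℝ^κ × ℝ^a × ℝ^l × ℝ^b` at the origin: the rescaled sets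
`δ_{1/rₙ}(Σ)` converge in the Kuratowski sense to the homogeneous algebraic variety
`A = {(0, u, Q(u,v), v)}`, where `Q` is the degree-2 homogeneous Taylor polynomial of `β`. -/
theorem blowup_kuratowski_convergence_two_step
    (κ a l b : ℕ)
    (dil : ℝ → (Fin κ → ℝ) × (Fin a → ℝ) × (Fin l → ℝ) × (Fin b → ℝ) →
      (Fin κ → ℝ) × (Fin a → ℝ) × (Fin l → ℝ) × (Fin b → ℝ))
    (hdil : ∀ (r : ℝ) x, dil r x = (r • x.1, r • x.2.1, r ^ 2 • x.2.2.1, r ^ 2 • x.2.2.2))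
    (Ω : Set ((Fin a → ℝ) × (Fin b → ℝ))) (hΩ : IsOpen Ω) (h0Ω : (0 : _) ∈ Ω)
    (α : (Fin a → ℝ) × (Fin b → ℝ) → (Fin κ → ℝ))
    (β : (Fin a → ℝ) × (Fin b → ℝ) → (Fin l → ℝ))
    (hα : ContDiffOn ℝ 2 α Ω) (hβ : ContDiffOn ℝ 2 β Ω)
    (hα0 : α 0 = 0) (hβ0 : β 0 = 0)
    (hαu : ∀ i : Fin a, fderiv ℝ α 0 (Pi.single i 1, 0) = 0)
    (hβu : ∀ i : Fin a, fderiv ℝ β 0 (Pi.single i 1, 0) = 0)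
    (S : Set ((Fin κ → ℝ) × (Fin a → ℝ) × (Fin l → ℝ) × (Fin b → ℝ)))
    (hS : S = {z | ∃ uv ∈ Ω, z = (α uv, uv.1, β uv, uv.2)})
    (Q : (Fin a → ℝ) × (Fin b → ℝ) → (Fin l → ℝ))
    (hQ : ∀ uv : (Fin a → ℝ) × (Fin b → ℝ), ∀ j : Fin l,
      Q uv j = (∑ k : Fin b,
          fderiv ℝ (fun w => β w j) 0 ((0 : Fin a → ℝ), Pi.single k 1) * uv.2 k)
        + (1 / 2) * ∑ i : Fin a, ∑ i' : Fin a,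
            (fderiv ℝ (fderiv ℝ (fun w => β w j)) 0 (Pi.single i 1, (0 : Fin b → ℝ)))
              (Pi.single i' 1, (0 : Fin b → ℝ)) * uv.1 i * uv.1 i')
    (A : Set ((Fin κ → ℝ) × (Fin a → ℝ) × (Fin l → ℝ) × (Fin b → ℝ)))
    (hA : A = {z | ∃ uv : (Fin a → ℝ) × (Fin b → ℝ), z = (0, uv.1, Q uv, uv.2)}) :
    ∀ r : ℕ → ℝ, (∀ n, 0 < r n) → Tendsto r atTop (𝓝 0) →
      (∀ z : ℕ → (Fin κ → ℝ) × (Fin a → ℝ) × (Fin l → ℝ) × (Fin b → ℝ),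
        (∀ n, z n ∈ dil (r n)⁻¹ '' S) →
        ∀ zl, Tendsto z atTop (𝓝 zl) → zl ∈ A) ∧
      (∀ zl ∈ A, ∃ z : ℕ → (Fin κ → ℝ) × (Fin a → ℝ) × (Fin l → ℝ) × (Fin b → ℝ),
        (∀ᶠ n in atTop, z n ∈ dil (r n)⁻¹ '' S) ∧ Tendsto z atTop (𝓝 zl)) := by
  subst hS hA
  intro r hr hr0
  have hnhds : Ω ∈ 𝓝 (0 : (Fin a → ℝ) × (Fin b → ℝ)) := hΩ.mem_nhds h0Ω
  have hα2 : ContDiffAt ℝ 2 α 0 := hα.contDiffAt hnhds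
  have hβ2 : ContDiffAt ℝ 2 β 0 := hβ.contDiffAt hnhds
  have hscale : ∀ {p : ℕ → (Fin a → ℝ) × (Fin b → ℝ)} {q}, Tendsto p atTop (𝓝 q) →
      Tendsto (fun n => ((p n).1, r n • (p n).2)) atTop (𝓝 (q.1, 0)) := by
    intro p q hp
    have hp1 : Tendsto (fun n => (p n).1) atTop (𝓝 q.1) := (continuous_fst.tendsto q).comp hp
    have hp2 : Tendsto (fun n => (p n).2) atTop (𝓝 q.2) := (continuous_snd.tendsto q).comp hp
    simpa using hp1.prodMk_nhds (hr0.smul hp2)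
  have hαlim : ∀ {p : ℕ → (Fin a → ℝ) × (Fin b → ℝ)} {q}, Tendsto p atTop (𝓝 q) →
      Tendsto (fun n => (r n)⁻¹ • α (r n • (p n).1, r n ^ 2 • (p n).2)) atTop (𝓝 0) := by
    intro p q hp
    have hd : HasFDerivAt α (fderiv ℝ α 0) 0 := (hα2.differentiableAt (by simp)).hasFDerivAt
    have hdir := (hd.hasFDerivWithinAt (s := Set.univ)).lim (α := ℕ) (l := atTop)
      (c := fun n => (r n)⁻¹) (d := fun n => (r n • (p n).1, r n ^ 2 • (p n).2))
      (v := (q.1, 0)) ?_ ?_ ?_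
    · rw [(fderiv ℝ α 0).apply_prod_zero_of_single hαu] at hdir
      simpa [hα0] using hdir
    · simpa [smul_smul, pow_two] using hr0.smul (hscale hp)
    · simp
    · refine (hscale hp).congr fun n => ?_
      have hne := (hr n).ne'
      simp [smul_smul, pow_two, hne]
  have hβlim : ∀ {p : ℕ → (Fin a → ℝ) × (Fin b → ℝ)} {q}, Tendsto p atTop (𝓝 q) →
      Tendsto (fun n => (r n)⁻¹ ^ 2 • β (r n • (p n).1, r n ^ 2 • (p n).2)) atTop
        (𝓝 (Q q)) := by
    intro p q hp
    rw [tendsto_pi_nhds]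
    intro j
    have hj : ContDiffAt ℝ 2 (fun w => β w j) 0 := contDiffAt_pi.1 hβ2 j
    have hju : ∀ u, fderiv ℝ (fun w => β w j) 0 (u, 0) = 0 := by
      refine ContinuousLinearMap.apply_prod_zero_of_single _ fun i => ?_
      rw [fderiv_apply (hβ2.differentiableAt (by simp))]
      simp [hβu]
    have hlim := hj.tendsto_parabolic_blowup (by simp [hβ0]) hju hr hr0 hp
    have hq1 : (q.1, (0 : Fin b → ℝ)) = ∑ i, q.1 i • (Pi.single i (1 : ℝ), (0 : Fin b → ℝ)) := by
      have := LinearMap.pi_apply_eq_sum_univ (LinearMap.inl ℝ (Fin a → ℝ) (Fin b → ℝ)) q.1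
      simpa [← Pi.single_apply, Pi.single_comm] using this
    have hq2 : ((0 : Fin a → ℝ), q.2) = ∑ k, q.2 k • ((0 : Fin a → ℝ), Pi.single k (1 : ℝ)) := by
      have := LinearMap.pi_apply_eq_sum_univ (LinearMap.inr ℝ (Fin a → ℝ) (Fin b → ℝ)) q.2
      simpa [← Pi.single_apply, Pi.single_comm] using this
    rw [hq1, hq2] at hlim
    simp only [map_sum, map_smul, _root_.sum_apply, _root_.smul_apply, smul_eq_mul] at hlim
    convert hlim using 2
    · simp
    rw [hQ]
    congr 1
    · exact Finset.sum_congr rfl fun k _ => mul_comm _ _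
    · congr 1
      rw [Finset.sum_comm]
      simp only [Finset.mul_sum]
      refine Finset.sum_congr rfl fun i _ => Finset.sum_congr rfl fun i' _ => ?_
      ring
  refine ⟨?_, ?_⟩
  · intro z hz zl hzl
    choose s hs hsz using hz
    choose w hwΩ hws using hs
    set p : ℕ → (Fin a → ℝ) × (Fin b → ℝ) := fun n => ((z n).2.1, (z n).2.2.2) with hp_def
    have hp : Tendsto p atTop (𝓝 (zl.2.1, zl.2.2.2)) :=
      ((by fun_prop : Continuous fun y : (Fin κ → ℝ) × (Fin a → ℝ) × (Fin l → ℝ) × (Fin b → ℝ) =>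
        (y.2.1, y.2.2.2)).tendsto zl).comp hzl
    have hz_eq : ∀ n, z n = ((r n)⁻¹ • α (w n), (r n)⁻¹ • (w n).1, (r n)⁻¹ ^ 2 • β (w n),
        (r n)⁻¹ ^ 2 • (w n).2) := fun n => by rw [← hsz, hdil, hws]
    have hwp : ∀ n, (r n • (p n).1, r n ^ 2 • (p n).2) = w n := fun n => by
      have hne := (hr n).ne'
      simp [hp_def, hz_eq, smul_smul, hne]
    have h1 := hαlim hp
    have h3 := hβlim hp
    simp only [hwp] at h1 h3
    have hz1 : Tendsto (fun n => (r n)⁻¹ • α (w n)) atTop (𝓝 zl.1) :=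
      ((continuous_fst.tendsto zl).comp hzl).congr fun n => by simp [hz_eq]
    have hz3 : Tendsto (fun n => (r n)⁻¹ ^ 2 • β (w n)) atTop (𝓝 zl.2.2.1) :=
      (((by fun_prop : Continuous fun y : (Fin κ → ℝ) × (Fin a → ℝ) × (Fin l → ℝ) × (Fin b → ℝ) =>
        y.2.2.1).tendsto zl).comp hzl).congr fun n => by simp [hz_eq]
    refine ⟨(zl.2.1, zl.2.2.2), ?_⟩
    rw [← tendsto_nhds_unique hz1 h1, ← tendsto_nhds_unique hz3 h3]
  · rintro zl ⟨q, rfl⟩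
    have hp : Tendsto (fun _ : ℕ => q) atTop (𝓝 q) := tendsto_const_nhds
    refine ⟨fun n => ((r n)⁻¹ • α (r n • q.1, r n ^ 2 • q.2), q.1,
      (r n)⁻¹ ^ 2 • β (r n • q.1, r n ^ 2 • q.2), q.2), ?_, ?_⟩
    · have hw0 : Tendsto (fun n => (r n • q.1, r n ^ 2 • q.2)) atTop (𝓝 0) := by
        simpa [smul_smul, pow_two] using hr0.smul (hscale hp)
      filter_upwards [hw0.eventually_mem hnhds] with n hn
      refine ⟨_, ⟨_, hn, rfl⟩, ?_⟩
      have hne := (hr n).ne'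
      simp [hdil, smul_smul, hne]
    · exact (hαlim hp).prodMk_nhds (tendsto_const_nhds.prodMk_nhds
        ((hβlim hp).prodMk_nhds tendsto_const_nhds))
end

section
/- Let φ : ℝ → ℝ be the inverse of the bijection t ↦ t + t³ of ℝ. Define Φ : ℝ³ → ℝ⁶ by Φ(x₁,y₁,y₂) = (x₁, y₁, x₁³, y₂, φ(x₁² + y₁² + x₁⁹), x₁²) and, for r > 0, the dilations δ_r(a₁,a₂,a₃,a₄,a₅,a₆) = (r a₁, r a₂, r a₃, r a₄, r² a₅, r² a₆) on ℝ⁶. Then for every (x₁,y₁,y₂) ∈ ℝ³, every sequence (x₁ⁿ, y₁ⁿ, y₂ⁿ) → (x₁,y₁,y₂) in ℝ³ and every sequence of positive reals r_n → 0, the points δ_{1/r_n}( Φ(r_n x₁ⁿ, r_n y₁ⁿ, r_n y₂ⁿ) ) converge in ℝ⁶ to (x₁, y₁, 0, y₂, x₁² + y₁², x₁²). -/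
open Filter Topology

/-- A solution `t` of `t + t ^ 3 = s` is dominated by `s`. -/
lemma abs_le_abs_of_add_pow_three_eq {t s : ℝ} (h : t + t ^ 3 = s) : |t| ≤ |s| := by
  have hs : s = t * (1 + t ^ 2) := by rw [← h]; ring
  rw [hs, abs_mul, abs_of_pos (by positivity : 0 < 1 + t ^ 2)]
  exact le_mul_of_one_le_right (abs_nonneg t) (by nlinarith [sq_nonneg t])

lemma eq_div_of_add_pow_three_eq {t s : ℝ} (h : t + t ^ 3 = s) : t = s / (1 + t ^ 2) := by
  rw [eq_div_iff (by positivity), ← h]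
  ring

/-- If `φ` is a right inverse of `t ↦ t + t ^ 3`, then `c n * φ (s n)` has the same limit as
`c n * s n` whenever `s n → 0`. -/
lemma tendsto_mul_of_add_pow_three_eq {φ : ℝ → ℝ} (hφ : ∀ s, φ s + φ s ^ 3 = s)
    {ι : Type*} {l : Filter ι} {c s : ι → ℝ} {a : ℝ} (hs : Tendsto s l (𝓝 0))
    (hcs : Tendsto (fun n => c n * s n) l (𝓝 a)) :
    Tendsto (fun n => c n * φ (s n)) l (𝓝 a) := by
  have hφs : Tendsto (fun n => φ (s n)) l (𝓝 0) :=
    squeeze_zero_norm (fun n => abs_le_abs_of_add_pow_three_eq (hφ (s n)))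
      (by simpa using hs.abs)
  have hden : Tendsto (fun n => 1 + φ (s n) ^ 2) l (𝓝 1) := by
    simpa using (hφs.pow 2).const_add 1
  have hquot := hcs.div hden one_ne_zero
  rw [div_one] at hquot
  refine hquot.congr fun n => ?_
  rw [Pi.div_apply, mul_div_assoc, ← eq_div_of_add_pow_three_eq (hφ (s n))]

/-- Blow-up of the parametrized surface
`Φ(x₁,y₁,y₂) = (x₁, y₁, x₁³, y₂, φ(x₁² + y₁² + x₁⁹), x₁²)` in `H¹ × H¹` at the origin,
where `φ` is the inverse of `t ↦ t + t³`: the rescaled points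
`δ_{1/rₙ}(Φ(rₙ x₁ⁿ, rₙ y₁ⁿ, rₙ y₂ⁿ))` converge to `(x₁, y₁, 0, y₂, x₁² + y₁², x₁²)`. -/
theorem blowup_example_heisenberg_times_heisenberg
    (φ : ℝ → ℝ)
    (hφ₁ : ∀ t : ℝ, φ (t + t ^ 3) = t)
    (hφ₂ : ∀ s : ℝ, φ s + φ s ^ 3 = s)
    (Φ : ℝ → ℝ → ℝ → Fin 6 → ℝ)
    (hΦ : ∀ x₁ y₁ y₂ : ℝ,
      Φ x₁ y₁ y₂ = ![x₁, y₁, x₁ ^ 3, y₂, φ (x₁ ^ 2 + y₁ ^ 2 + x₁ ^ 9), x₁ ^ 2])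
    (dil : ℝ → (Fin 6 → ℝ) → Fin 6 → ℝ)
    (hdil : ∀ (r : ℝ) (z : Fin 6 → ℝ),
      dil r z = ![r * z 0, r * z 1, r * z 2, r * z 3, r ^ 2 * z 4, r ^ 2 * z 5]) :
    ∀ (x₁ y₁ y₂ : ℝ) (xs ys zs : ℕ → ℝ),
      Tendsto xs atTop (𝓝 x₁) → Tendsto ys atTop (𝓝 y₁) → Tendsto zs atTop (𝓝 y₂) →
      ∀ r : ℕ → ℝ, (∀ n, 0 < r n) → Tendsto r atTop (𝓝 0) →
        Tendsto (fun n => dil (r n)⁻¹ (Φ (r n * xs n) (r n * ys n) (r n * zs n)))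
          atTop (𝓝 ![x₁, y₁, 0, y₂, x₁ ^ 2 + y₁ ^ 2, x₁ ^ 2]) := by
  intro x₁ y₁ y₂ xs ys zs hx hy hz r hr hr0
  have hne : ∀ n, r n ≠ 0 := fun n => (hr n).ne'
  have hrx : Tendsto (fun n => r n * xs n) atTop (𝓝 0) := by simpa using hr0.mul hx
  have hry : Tendsto (fun n => r n * ys n) atTop (𝓝 0) := by simpa using hr0.mul hy
  have hcancel : ∀ (u : ℕ → ℝ) (n : ℕ), (r n)⁻¹ * (r n * u n) = u n := fun u n =>
    inv_mul_cancel_left₀ (hne n) (u n)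
  have hcube : Tendsto (fun n => (r n)⁻¹ * (r n * xs n) ^ 3) atTop (𝓝 0) := by
    have h : Tendsto (fun n => r n ^ 2 * xs n ^ 3) atTop (𝓝 0) := by
      simpa using (hr0.pow 2).mul (hx.pow 3)
    refine h.congr fun n => ?_
    have := hne n
    field_simp
  have hsq : Tendsto (fun n => (r n)⁻¹ ^ 2 * (r n * xs n) ^ 2) atTop (𝓝 (x₁ ^ 2)) := by
    refine (hx.pow 2).congr fun n => ?_
    rw [← mul_pow, hcancel]
  have hvert : Tendsto (fun n => (r n)⁻¹ ^ 2 *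
      φ ((r n * xs n) ^ 2 + (r n * ys n) ^ 2 + (r n * xs n) ^ 9)) atTop
      (𝓝 (x₁ ^ 2 + y₁ ^ 2)) := by
    refine tendsto_mul_of_add_pow_three_eq hφ₂ ?_ ?_
    · simpa using ((hrx.pow 2).add (hry.pow 2)).add (hrx.pow 9)
    · have h : Tendsto (fun n => xs n ^ 2 + ys n ^ 2 + r n ^ 7 * xs n ^ 9) atTop
          (𝓝 (x₁ ^ 2 + y₁ ^ 2)) := by
        simpa using ((hx.pow 2).add (hy.pow 2)).add ((hr0.pow 7).mul (hx.pow 9))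
      refine h.congr fun n => ?_
      have := hne n
      field_simp
  rw [tendsto_pi_nhds]
  intro i
  fin_cases i
  · simpa [hdil, hΦ, hcancel] using hx
  · simpa [hdil, hΦ, hcancel] using hy
  · simpa [hdil, hΦ] using hcube
  · simpa [hdil, hΦ, hcancel] using hz
  · simpa [hdil, hΦ] using hvert
  · simpa [hdil, hΦ] using hsq
end

section
/- The set A = { (x, y, 0, z, x² + y², x²) : x, y, z ∈ ℝ } ⊆ ℝ⁶ is invariant under all the dilations δ_r(a₁,a₂,a₃,a₄,a₅,a₆) = (r a₁, r a₂, r a₃, r a₄, r² a₅, r² a₆), r > 0, i.e. δ_r(A) = A, but A is not a linear subspace of ℝ⁶. -/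
/-- The set `A = {(x, y, 0, z, x² + y², x²)} ⊆ ℝ⁶` is invariant under all the
anisotropic dilations `δ_r` (weight 1 on the first four coordinates, weight 2 on the last
two), but it is not a linear subspace of `ℝ⁶`. -/
theorem blowup_variety_dilation_invariant_not_subspace
    (A : Set (Fin 6 → ℝ))
    (hA : A = {w | ∃ x y z : ℝ, w = ![x, y, 0, z, x ^ 2 + y ^ 2, x ^ 2]})
    (dil : ℝ → (Fin 6 → ℝ) → Fin 6 → ℝ)
    (hdil : ∀ (r : ℝ) (w : Fin 6 → ℝ),
      dil r w = ![r * w 0, r * w 1, r * w 2, r * w 3, r ^ 2 * w 4, r ^ 2 * w 5]) :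
    (∀ r : ℝ, 0 < r → dil r '' A = A) ∧
    ¬ ∃ p : Submodule ℝ (Fin 6 → ℝ), (p : Set (Fin 6 → ℝ)) = A := by
  subst hA
  have dil_point (r x y z : ℝ) : dil r ![x, y, 0, z, x ^ 2 + y ^ 2, x ^ 2] =
      ![r * x, r * y, 0, r * z, (r * x) ^ 2 + (r * y) ^ 2, (r * x) ^ 2] := by
    rw [hdil]
    ext i
    fin_cases i <;> simp <;> ring
  refine ⟨fun r hr => Set.Subset.antisymm ?_ ?_, ?_⟩
  · rintro _ ⟨_, ⟨x, y, z, rfl⟩, rfl⟩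
    exact ⟨r * x, r * y, r * z, dil_point r x y z⟩
  · rintro _ ⟨x, y, z, rfl⟩
    refine ⟨_, ⟨x / r, y / r, z / r, rfl⟩, ?_⟩
    rw [dil_point]
    simp only [mul_div_cancel₀ _ hr.ne']
  · rintro ⟨p, hp⟩
    have hmem : ![(1 : ℝ), 0, 0, 0, 1 ^ 2 + 0 ^ 2, 1 ^ 2] ∈ p := by
      rw [← SetLike.mem_coe, hp]
      exact ⟨1, 0, 0, rfl⟩
    have hneg := p.neg_mem hmem
    rw [← SetLike.mem_coe, hp] at hneg
    obtain ⟨x, y, z, h⟩ := hneg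
    have h5 : -1 = x ^ 2 := by simpa using congrFun h 5
    linarith [sq_nonneg x]
end
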